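/- For every sequence λ = (λ_{IJ}) and all dyadic intervals I₀, J₀, there holds ((|I₀||J₀|)^{-1} Σ_{J∈D, J⊆J₀} λ_{I₀J}²)^{1/2} ≤ ‖λ‖_X, and symmetrically ((|I₀||J₀|)^{-1} Σ_{I∈D, I⊆I₀} λ_{IJ₀}²)^{1/2} ≤ ‖λ‖_X. Thus L²-boundedness of P_λ implies a one-parameter BMO condition on λ in each variable separately. -/

import Mathlib

open MeasureTheory
open scoped ENNReal

noncomputable section

/-- A sequence `λ = (λ_{IJ})` indexed by pairs of dyadic intervals; a dyadic interval
`[2^{-i}k, 2^{-i}(k+1))` is encoded by the pair `(i, k) : ℤ × ℤ`. -/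
abbrev ParaSeq := (ℤ × ℤ) → (ℤ × ℤ) → ℝ

/-- The dyadic interval `[2^{-i} k, 2^{-i}(k+1))` encoded by the pair `p = (i, k) : ℤ × ℤ`. -/
def dyadic (p : ℤ × ℤ) : Set ℝ := Set.Ico ((2:ℝ) ^ (-p.1) * p.2) ((2:ℝ) ^ (-p.1) * (p.2 + 1))

/-- The length `|I| = 2^{-i}` of the dyadic interval encoded by `p = (i, k)`. -/
def dlen (p : ℤ × ℤ) : ℝ := (2:ℝ) ^ (-p.1)

/-- The average `⟨f⟩_I = |I|⁻¹ ∫_I f`. -/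
def avg (f : ℝ → ℝ) (p : ℤ × ℤ) : ℝ := (dlen p)⁻¹ * ∫ x in dyadic p, f x

/-- Admissible families `(u_I)_{I ∈ D}` of `L²(ℝ)` functions: only finitely many nonzero
members and `Σ_I ‖u_I‖₂² = 1`. -/
def Adm : Set ((ℤ × ℤ) → ℝ → ℝ) :=
  {u | (∀ p, MemLp (u p) 2 volume) ∧ {p | u p ≠ 0}.Finite ∧ (∑' p : ℤ × ℤ, ∫ x, (u p x) ^ 2) = 1}

/-- The bilinear sum `Σ_{I,J} λ_{IJ} ⟨g_J⟩_I ⟨u_I⟩_J`. -/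
def pairSum (lam : ParaSeq) (u g : (ℤ × ℤ) → ℝ → ℝ) : ℝ :=
  ∑' pq : (ℤ × ℤ) × (ℤ × ℤ), lam pq.1 pq.2 * avg (g pq.2) pq.1 * avg (u pq.1) pq.2

/-- The norm `‖λ‖_X`, as an element of `[0, ∞]`. -/
def Xnorm (lam : ParaSeq) : ℝ≥0∞ :=
  ⨆ (u : Adm) (g : Adm), ENNReal.ofReal |pairSum lam u.1 g.1|

/-- The norm `‖λ‖_{X'}`, as an element of `[0, ∞]`. -/
def Xprime (lam : ParaSeq) : ℝ≥0∞ :=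
  ⨆ (u : Adm) (g : Adm),
    ENNReal.ofReal
      (∑' pq : (ℤ × ℤ) × (ℤ × ℤ), |lam pq.1 pq.2 * avg (g.1 pq.2) pq.1 * avg (u.1 pq.1) pq.2|)

lemma dlen_pos (p : ℤ × ℤ) : 0 < dlen p := by unfold dlen; positivity

lemma volume_dyadic (p : ℤ × ℤ) : volume (dyadic p) = ENNReal.ofReal (dlen p) := by
  rw [dyadic, Real.volume_Ico, dlen]; congr 1; ring

lemma measurableSet_dyadic (p : ℤ × ℤ) : MeasurableSet (dyadic p) := measurableSet_Ico

lemma measureReal_dyadic (p : ℤ × ℤ) : volume.real (dyadic p) = dlen p := by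
  rw [Measure.real, volume_dyadic, ENNReal.toReal_ofReal (dlen_pos p).le]

/-- The family whose member at `r ∈ F` is `c r` times the `L²`-normalized indicator of the
dyadic interval `q`, and whose other members vanish. -/
def indicatorFamily (F : Finset (ℤ × ℤ)) (c : (ℤ × ℤ) → ℝ) (q r : ℤ × ℤ) : ℝ → ℝ :=
  (dyadic q).indicator fun _ => if r ∈ F then c r / √(dlen q) else 0

lemma indicatorFamily_of_notMem {F : Finset (ℤ × ℤ)} (c : (ℤ × ℤ) → ℝ) (q : ℤ × ℤ)
    {r : ℤ × ℤ} (hr : r ∉ F) : indicatorFamily F c q r = 0 := by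
  funext x
  simp [indicatorFamily, hr]

lemma integral_indicatorFamily_sq {F : Finset (ℤ × ℤ)} (c : (ℤ × ℤ) → ℝ) (q : ℤ × ℤ)
    {r : ℤ × ℤ} (hr : r ∈ F) : ∫ x, (indicatorFamily F c q r x) ^ 2 = c r ^ 2 := by
  have h : (fun x => (indicatorFamily F c q r x) ^ 2) =
      (dyadic q).indicator fun _ => c r ^ 2 / dlen q := by
    funext x
    by_cases hx : x ∈ dyadic q <;>
      simp [indicatorFamily, hr, hx, div_pow, Real.sq_sqrt (dlen_pos q).le]
  rw [h, integral_indicator (measurableSet_dyadic q), setIntegral_const, measureReal_dyadic,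
    smul_eq_mul, mul_div_cancel₀ _ (dlen_pos q).ne']

lemma indicatorFamily_mem_Adm {F : Finset (ℤ × ℤ)} {c : (ℤ × ℤ) → ℝ} (q : ℤ × ℤ)
    (hc : ∑ r ∈ F, c r ^ 2 = 1) : indicatorFamily F c q ∈ Adm := by
  refine ⟨fun r => ?_, F.finite_toSet.subset fun r hr => ?_, ?_⟩
  · refine memLp_indicator_const 2 (measurableSet_dyadic q) _ (Or.inr ?_)
    rw [volume_dyadic]
    exact ENNReal.ofReal_ne_top
  · by_contra h
    exact hr (indicatorFamily_of_notMem c q h)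
  · rw [tsum_eq_sum (s := F), ← hc]
    · exact Finset.sum_congr rfl fun r hr => integral_indicatorFamily_sq c q hr
    · intro r hr
      simp [indicatorFamily_of_notMem c q hr]

lemma avg_zero (p : ℤ × ℤ) : avg 0 p = 0 := by simp [avg]

lemma avg_indicatorFamily {F : Finset (ℤ × ℤ)} (c : (ℤ × ℤ) → ℝ) {q r s : ℤ × ℤ}
    (hr : r ∈ F) (hs : dyadic s ⊆ dyadic q) :
    avg (indicatorFamily F c q r) s = c r / √(dlen q) := by
  have h : ∫ x in dyadic s, indicatorFamily F c q r x =
      ∫ _ in dyadic s, c r / √(dlen q) := by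
    refine setIntegral_congr_fun (measurableSet_dyadic s) fun x hx => ?_
    simp [indicatorFamily, hr, hs hx]
  rw [avg, h, setIntegral_const, measureReal_dyadic, smul_eq_mul,
    inv_mul_cancel_left₀ (dlen_pos s).ne']

lemma pairSum_indicatorFamily (lam : ParaSeq) (p q : ℤ × ℤ) (F : Finset (ℤ × ℤ))
    (c : (ℤ × ℤ) → ℝ) (hF : ∀ r ∈ F, dyadic r ⊆ dyadic q) :
    pairSum lam (indicatorFamily {p} 1 q) (indicatorFamily F c p) =
      (∑ r ∈ F, lam p r * c r) / √(dlen p * dlen q) := by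
  rw [pairSum, tsum_eq_sum (s := {p} ×ˢ F), Finset.sum_product, Finset.sum_singleton,
    Finset.sum_div]
  · refine Finset.sum_congr rfl fun r hr => ?_
    rw [avg_indicatorFamily c hr subset_rfl,
      avg_indicatorFamily 1 (Finset.mem_singleton_self p) (hF r hr),
      Real.sqrt_mul (dlen_pos p).le, Pi.one_apply]
    ring
  · rintro ⟨a, b⟩ h
    rw [Finset.mem_product, not_and_or] at h
    rcases h with h | h <;> simp [indicatorFamily_of_notMem _ _ h, avg_zero]

lemma le_Xnorm (lam : ParaSeq) {u g : (ℤ × ℤ) → ℝ → ℝ} (hu : u ∈ Adm) (hg : g ∈ Adm) :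
    ENNReal.ofReal |pairSum lam u g| ≤ Xnorm lam :=
  le_iSup₂_of_le (⟨u, hu⟩ : Adm) (⟨g, hg⟩ : Adm) le_rfl

lemma sum_sq_le_Xnorm_sq (lam : ParaSeq) (p q : ℤ × ℤ) (F : Finset (ℤ × ℤ))
    (hF : ∀ r ∈ F, dyadic r ⊆ dyadic q) :
    ENNReal.ofReal ((dlen p * dlen q)⁻¹ * ∑ r ∈ F, lam p r ^ 2) ≤ Xnorm lam ^ 2 := by
  set S := ∑ r ∈ F, lam p r ^ 2 with hS
  have hS0 : 0 ≤ S := Finset.sum_nonneg fun r _ => sq_nonneg _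
  rcases hS0.eq_or_lt with h0 | hpos
  · simp [← h0]
  have hc : ∑ r ∈ F, (lam p r / √S) ^ 2 = 1 := by
    simp_rw [div_pow, Real.sq_sqrt hS0]
    rw [← Finset.sum_div, ← hS, div_self hpos.ne']
  have h1 : ∑ r ∈ ({p} : Finset (ℤ × ℤ)), (1 : ℤ × ℤ → ℝ) r ^ 2 = 1 := by simp
  have key := le_Xnorm lam (indicatorFamily_mem_Adm q h1) (indicatorFamily_mem_Adm p hc)
  rw [pairSum_indicatorFamily lam p q F _ hF] at key
  have hd : 0 < dlen p * dlen q := mul_pos (dlen_pos p) (dlen_pos q)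
  have hsum : ∑ r ∈ F, lam p r * (lam p r / √S) = √S := by
    simp_rw [← mul_div_assoc, ← sq]
    rw [← Finset.sum_div, ← hS, Real.div_sqrt]
  rw [hsum, abs_of_nonneg (by positivity)] at key
  calc _ = ENNReal.ofReal (√S / √(dlen p * dlen q)) ^ 2 := by
        rw [← ENNReal.ofReal_pow (by positivity), div_pow, Real.sq_sqrt hS0, Real.sq_sqrt hd.le,
          div_eq_inv_mul]
    _ ≤ _ := by gcongr

lemma onePar_BMO_fst_le_Xnorm (lam : ParaSeq) (p q : ℤ × ℤ) :
    ((ENNReal.ofReal (dlen p * dlen q))⁻¹ *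
        ∑' q' : {q' : ℤ × ℤ // dyadic q' ⊆ dyadic q},
          ENNReal.ofReal ((lam p q'.1) ^ 2)) ^ (1/2 : ℝ) ≤ Xnorm lam := by
  have hd : 0 < dlen p * dlen q := mul_pos (dlen_pos p) (dlen_pos q)
  rw [one_div, ENNReal.rpow_inv_le_iff two_pos, ENNReal.rpow_ofNat, ENNReal.tsum_eq_iSup_sum,
    ENNReal.mul_iSup]
  refine iSup_le fun F => ?_
  have h := sum_sq_le_Xnorm_sq lam p q (F.map (Function.Embedding.subtype _)) fun r hr => by
    obtain ⟨s, -, rfl⟩ := Finset.mem_map.1 hr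
    exact s.2
  rwa [Finset.sum_map, ENNReal.ofReal_mul (inv_nonneg.2 hd.le), ENNReal.ofReal_inv_of_pos hd,
    ENNReal.ofReal_sum_of_nonneg fun _ _ => sq_nonneg _] at h

lemma pairSum_swap (lam : ParaSeq) (u g : (ℤ × ℤ) → ℝ → ℝ) :
    pairSum (fun a b => lam b a) u g = pairSum lam g u := by
  rw [pairSum, pairSum, ← (Equiv.prodComm (ℤ × ℤ) (ℤ × ℤ)).tsum_eq]
  exact tsum_congr fun pq => mul_right_comm _ _ _

lemma Xnorm_swap (lam : ParaSeq) : Xnorm (fun a b => lam b a) = Xnorm lam := by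
  rw [Xnorm, Xnorm, iSup_comm]
  simp_rw [pairSum_swap]

/-- for all dyadic `I₀, J₀`,
`((|I₀||J₀|)⁻¹ Σ_{J ⊆ J₀} λ_{I₀J}²)^{1/2} ≤ ‖λ‖_X`, and symmetrically
`((|I₀||J₀|)⁻¹ Σ_{I ⊆ I₀} λ_{IJ₀}²)^{1/2} ≤ ‖λ‖_X`. -/
theorem onePar_BMO_le_Xnorm (lam : ParaSeq) (p q : ℤ × ℤ) :
    ((ENNReal.ofReal (dlen p * dlen q))⁻¹ *
        ∑' q' : {q' : ℤ × ℤ // dyadic q' ⊆ dyadic q},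
          ENNReal.ofReal ((lam p q'.1) ^ 2)) ^ (1/2 : ℝ) ≤ Xnorm lam ∧
    ((ENNReal.ofReal (dlen p * dlen q))⁻¹ *
        ∑' p' : {p' : ℤ × ℤ // dyadic p' ⊆ dyadic p},
          ENNReal.ofReal ((lam p'.1 q) ^ 2)) ^ (1/2 : ℝ) ≤ Xnorm lam := by
  refine ⟨onePar_BMO_fst_le_Xnorm lam p q, ?_⟩
  rw [mul_comm (dlen p), ← Xnorm_swap lam]
  exact onePar_BMO_fst_le_Xnorm (fun a b => lam b a) q p

end
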